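/- (Odd Pieri rule.) Let α = (α_1 ≥ α_2 ≥ ⋯ ≥ α_a ≥ 0) be a partition with at most a parts and let 1 ≤ k ≤ a. Then in OΛ_a, s_α · s_{(1^k)} = Σ (−1)^{Σ_{j=1}^{k} (α_{i_j+1} + α_{i_j+2} + ⋯ + α_a)} s_μ, where the sum runs over all sequences 1 ≤ i_1 < i_2 < ⋯ < i_k ≤ a such that μ, the composition obtained from α by adding 1 to each of the entries α_{i_1},…,α_{i_k}, is again a partition (weakly decreasing). -/

import Mathlib

open scoped BigOperators

/-- The defining anticommutation relations of the odd polynomial ring. -/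
inductive OddRel (a : ℕ) : FreeAlgebra ℤ (Fin a) → FreeAlgebra ℤ (Fin a) → Prop
  | anticomm (i j : Fin a) (h : i ≠ j) :
      OddRel a (FreeAlgebra.ι ℤ i * FreeAlgebra.ι ℤ j)
        (-(FreeAlgebra.ι ℤ j * FreeAlgebra.ι ℤ i))

/-- The ring of odd polynomials in `a` variables over `ℤ`. -/
abbrev OPol (a : ℕ) : Type := RingQuot (OddRel a)

/-- The variable `x_{i+1}` (`0`-based index). -/
noncomputable def OX {a : ℕ} (i : Fin a) : OPol a :=
  RingQuot.mkRingHom (OddRel a) (FreeAlgebra.ι ℤ i)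

/-- The variable `x_i` (`1`-based index), `0` if out of range. -/
noncomputable def xv (a : ℕ) (i : ℕ) : OPol a :=
  if h : 1 ≤ i ∧ i ≤ a then OX ⟨i - 1, by omega⟩ else 0

/-- The signed variable `x̃_i = (−1)^{i−1} x_i` (`0`-based index, so the sign is `(−1)^i`). -/
noncomputable def xt (a : ℕ) (i : Fin a) : OPol a := (-1 : OPol a) ^ (i : ℕ) * OX i

/-- Odd elementary symmetric polynomial `ε_k`. -/
noncomputable def eps (a k : ℕ) : OPol a :=
  ∑ t ∈ Finset.powersetCard k (Finset.univ : Finset (Fin a)),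
    ((t.sort (· ≤ ·)).map (xt a)).prod

/-- Odd complete symmetric polynomial `h_k`. -/
noncomputable def hp (a k : ℕ) : OPol a :=
  ∑ σ : Sym (Fin a) k, (((σ : Multiset (Fin a)).sort (· ≤ ·)).map (xt a)).prod

/-- The ordered monomial `x_1^{c_1} ⋯ x_a^{c_a}`. -/
noncomputable def xmon {a : ℕ} (c : Fin a → ℕ) : OPol a :=
  ((List.finRange a).map fun i => OX i ^ c i).prod

/-- The staircase monomial `x^{δ_a} = x_1^{a−1} x_2^{a−2} ⋯ x_a^0`. -/
noncomputable def xdelta (a : ℕ) : OPol a :=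
  ((List.finRange a).map fun i => OX i ^ (a - 1 - (i : ℕ))).prod

/-- Composite of the operators `d i` along a word, leftmost letter acting last (outermost). -/
noncomputable def dword {a : ℕ} (d : ℕ → OPol a →+ OPol a) : List ℕ → (OPol a →+ OPol a)
  | [] => AddMonoidHom.id _
  | i :: l => (d i).comp (dword d l)

/-- The word `1, (2,1), (3,2,1), …, (a−1,…,2,1)` for the longest element, so that
`dword d (DList a) = ∂_1∘(∂_2∘∂_1)∘⋯∘(∂_{a−1}∘⋯∘∂_1) = D_a`. -/
def DList (a : ℕ) : List ℕ :=
  ((List.range a).map fun b => (List.range b).reverse.map (· + 1)).flatten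

/-- Left multiplication by `f` as a `ℤ`-linear endomorphism. -/
noncomputable def mulL {a : ℕ} (f : OPol a) : Module.End ℤ (OPol a) :=
  (AddMonoidHom.mulLeft f).toIntLinearMap

/-- The generators of the odd nilHecke ring inside `End_ℤ(OPol a)`. -/
noncomputable def onhGens (a : ℕ) (d : ℕ → OPol a →+ OPol a) :
    Set (Module.End ℤ (OPol a)) :=
  {T | (∃ i : Fin a, T = mulL (OX i)) ∨
    (∃ i : ℕ, 1 ≤ i ∧ i + 1 ≤ a ∧ T = (d i).toIntLinearMap)}

/-- The simple transposition `s_i` (`1`-based) of `{1,…,a}`. -/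
def sperm (a : ℕ) (i : ℕ) : Equiv.Perm (Fin a) :=
  if h : 1 ≤ i ∧ i + 1 ≤ a then Equiv.swap ⟨i - 1, by omega⟩ ⟨i, by omega⟩ else 1

/-- The permutation associated to a word in the simple transpositions. -/
def wordPerm (a : ℕ) (l : List ℕ) : Equiv.Perm (Fin a) := (l.map (sperm a)).prod

/-- Evaluation of an (even) multivariate polynomial at the squared variables `x_1², …, x_a²`. -/
noncomputable def sqEval {a : ℕ} (p : MvPolynomial (Fin a) ℤ) : OPol a :=
  ∑ m ∈ p.support,
    MvPolynomial.coeff m p • ((List.finRange a).map fun i => OX i ^ (2 * m i)).prod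

/-- The odd symmetrization operator `S(f) = (−1)^{C(a,3)} w₀(D_a(f·x^{δ_a}))`. -/
noncomputable def oddSymzn (a : ℕ) (d : ℕ → OPol a →+ OPol a) (W0 : OPol a →+* OPol a)
    (f : OPol a) : OPol a :=
  (-1 : OPol a) ^ Nat.choose a 3 * W0 (dword d (DList a) (f * xdelta a))

/-- The odd Schur polynomial `s_α = (−1)^{C(a,3)} w₀(D_a(x^α·x^{δ_a}))`. -/
noncomputable def schurP (a : ℕ) (d : ℕ → OPol a →+ OPol a) (W0 : OPol a →+* OPol a)
    (α : Fin a → ℕ) : OPol a :=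
  (-1 : OPol a) ^ Nat.choose a 3 * W0 (dword d (DList a) (xmon α * xdelta a))

/-- The 0-Hecke generator `∂̄_r = x_r ∘ ∂_r`. -/
noncomputable def dbar (a : ℕ) (d : ℕ → OPol a →+ OPol a) (r : ℕ) : OPol a →+ OPol a :=
  (AddMonoidHom.mulLeft (xv a r)).comp (d r)

/-- The `ℤ`-span of products of exactly `n` variables: the degree-`2n` component of `OPol a`. -/
def degComp (a n : ℕ) : Submodule ℤ (OPol a) :=
  Submodule.span ℤ {f : OPol a | ∃ l : List (Fin a), l.length = n ∧ f = (l.map OX).prod}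

/-- Odd Schubert polynomial `𝔰_w = ∂_{w⁻¹w₀}(x^{δ_a})` for a fixed choice `red` of
reduced expressions. -/
noncomputable def schubert (a : ℕ) (d : ℕ → OPol a →+ OPol a)
    (red : Equiv.Perm (Fin a) → List ℕ) (w : Equiv.Perm (Fin a)) : OPol a :=
  dword d (red (w⁻¹ * Fin.revPerm)) (xdelta a)

/-- Product of odd elementary symmetric polynomials along the parts of a partition,
in non-increasing order. -/
noncomputable def epsPart (a : ℕ) {n : ℕ} (p : Nat.Partition n) : OPol a :=
  (((p.parts.sort (· ≤ ·)).reverse).map (eps a)).prod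

/-- The variables `x` pairwise anticommute and generate the ring `R`, and the operators `d i`
are the odd divided differences twisted by the automorphisms `s i`. -/
structure IsOddDividedDifference {R : Type*} [Ring R] {a : ℕ} (x : Fin a → R)
    (s : ℕ → R →+* R) (d : ℕ → R →+ R) : Prop where
  anticomm : ∀ i j, i ≠ j → x i * x j = -(x j * x i)
  closure_range : Subring.closure (Set.range x) = ⊤
  map_fst : ∀ p q : Fin a, (q : ℕ) = p + 1 → s q (x p) = -x q
  map_snd : ∀ p q : Fin a, (q : ℕ) = p + 1 → s q (x q) = -x p
  map_far : ∀ q j : Fin a, 1 ≤ (q : ℕ) → (q : ℕ) ≠ j + 1 → j ≠ q → s q (x j) = -x j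
  diff_one : ∀ q : Fin a, 1 ≤ (q : ℕ) → d q 1 = 0
  diff_fst : ∀ p q : Fin a, (q : ℕ) = p + 1 → d q (x p) = 1
  diff_snd : ∀ p q : Fin a, (q : ℕ) = p + 1 → d q (x q) = 1
  diff_far : ∀ q j : Fin a, 1 ≤ (q : ℕ) → (q : ℕ) ≠ j + 1 → j ≠ q → d q (x j) = 0
  leibniz : ∀ q : Fin a, 1 ≤ (q : ℕ) → ∀ f g, d q (f * g) = d q f * g + s q f * d q g

namespace IsOddDividedDifference

variable {R : Type*} [Ring R] {a : ℕ} {x : Fin a → R} {s : ℕ → R →+* R} {d : ℕ → R →+ R}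

/-- An additive property holds everywhere if it holds for `1` and is stable under left
multiplication by the variables. -/
lemma induction_left (h : IsOddDividedDifference x s d) {P : R → Prop} (one : P 1)
    (add : ∀ f g, P f → P g → P (f + g)) (neg : ∀ f, P f → P (-f))
    (mul : ∀ i g, P g → P (x i * g)) (f : R) : P f := by
  suffices H : ∀ g, P g → P (f * g) by simpa using H 1 one
  have hf : f ∈ Subring.closure (Set.range x) := h.closure_range ▸ Subring.mem_top f
  induction hf using Subring.closure_induction with
  | mem f hf =>
    obtain ⟨i, rfl⟩ := hf
    exact mul i
  | zero =>
    intro g _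
    simpa using add 1 (-1) one (neg 1 one)
  | one => simp
  | add f₁ f₂ _ _ h₁ h₂ =>
    intro g hg
    rw [add_mul]
    exact add _ _ (h₁ _ hg) (h₂ _ hg)
  | neg f _ hf =>
    intro g hg
    rw [neg_mul]
    exact neg _ (hf _ hg)
  | mul f₁ f₂ _ _ h₁ h₂ =>
    intro g hg
    rw [mul_assoc]
    exact h₁ _ (h₂ _ hg)

lemma diff_fst_mul (h : IsOddDividedDifference x s d) {p q : Fin a} (hpq : (q : ℕ) = p + 1)
    (g : R) : d q (x p * g) = g - x q * d q g := by
  rw [h.leibniz q (by lia), h.diff_fst p q hpq, h.map_fst p q hpq, one_mul, neg_mul,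
    sub_eq_add_neg]

lemma diff_snd_mul (h : IsOddDividedDifference x s d) {p q : Fin a} (hpq : (q : ℕ) = p + 1)
    (g : R) : d q (x q * g) = g - x p * d q g := by
  rw [h.leibniz q (by lia), h.diff_snd p q hpq, h.map_snd p q hpq, one_mul, neg_mul,
    sub_eq_add_neg]

lemma diff_far_mul (h : IsOddDividedDifference x s d) {q j : Fin a} (hq0 : 1 ≤ (q : ℕ))
    (hj : (q : ℕ) ≠ j + 1) (hj' : j ≠ q) (g : R) : d q (x j * g) = -(x j * d q g) := by
  rw [h.leibniz q hq0, h.diff_far q j hq0 hj hj', h.map_far q j hq0 hj hj', zero_mul, zero_add,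
    neg_mul]

lemma diff_mul_of_diff_eq_zero (h : IsOddDividedDifference x s d) {q : Fin a} (hq : 1 ≤ (q : ℕ))
    {e : R} (he : d q e = 0) (f : R) :
    d q (f * e) = d q f * e := by
  rw [h.leibniz q hq, he, mul_zero, add_zero]

lemma diff_diff (h : IsOddDividedDifference x s d) {p q : Fin a} (hpq : (q : ℕ) = p + 1)
    (f : R) : d q (d q f) = 0 := by
  have hq := q.isLt
  induction f using h.induction_left with
  | one => rw [h.diff_one q (by lia), map_zero]
  | add f g hf hg => rw [map_add, map_add, hf, hg, add_zero]
  | neg f hf => rw [map_neg, map_neg, hf, neg_zero]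
  | mul j g hg =>
    by_cases hj : j = p
    · subst hj
      rw [h.diff_fst_mul hpq, map_sub, h.diff_snd_mul hpq, hg]
      simp
    by_cases hj' : j = q
    · subst hj'
      rw [h.diff_snd_mul hpq, map_sub, h.diff_fst_mul hpq, hg]
      simp
    · have hne : (q : ℕ) ≠ j + 1 := fun e => hj (Fin.ext (by lia))
      rw [h.diff_far_mul (by lia) hne hj', map_neg, h.diff_far_mul (by lia) hne hj', hg]
      simp

lemma diff_anticomm (h : IsOddDividedDifference x s d) {p q p' q' : Fin a}
    (hpq : (q : ℕ) = p + 1) (hpq' : (q' : ℕ) = p' + 1) (hq : (q : ℕ) < p') (f : R) :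
    d q (d q' f) = -d q' (d q f) := by
  have hq' := q'.isLt
  induction f using h.induction_left with
  | one =>
    rw [h.diff_one q (by lia), h.diff_one q' (by lia), map_zero, map_zero,
      neg_zero]
  | add f g hf hg => simp only [map_add, hf, hg, neg_add]
  | neg f hf => simp only [map_neg, hf]
  | mul j g hg =>
    have far {r t : Fin a} (hr : 1 ≤ (r : ℕ)) (h1 : (r : ℕ) ≠ t + 1) (h2 : (t : ℕ) ≠ r)
        (g : R) : d r (x t * g) = -(x t * d r g) :=
      h.diff_far_mul hr h1 (fun e => h2 (congrArg _ e)) g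
    by_cases hj : j = p
    · subst hj
      simp only [h.diff_fst_mul hpq, far (r := q') (t := j) (by lia) (by lia) (by lia),
        far (r := q') (t := q) (by lia) (by lia) (by lia), map_sub, map_neg, hg]
      noncomm_ring
    by_cases hj' : j = q
    · subst hj'
      simp only [h.diff_snd_mul hpq, far (r := q') (t := j) (by lia) (by lia) (by lia),
        far (r := q') (t := p) (by lia) (by lia) (by lia), map_sub, map_neg, hg]
      noncomm_ring
    by_cases hk : j = p'
    · subst hk
      simp only [h.diff_fst_mul hpq', far (r := q) (t := j) (by lia) (by lia) (by lia),
        far (r := q) (t := q') (by lia) (by lia) (by lia), map_sub, map_neg, hg]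
      noncomm_ring
    by_cases hk' : j = q'
    · subst hk'
      simp only [h.diff_snd_mul hpq', far (r := q) (t := j) (by lia) (by lia) (by lia),
        far (r := q) (t := p') (by lia) (by lia) (by lia), map_sub, map_neg, hg]
      noncomm_ring
    · rw [Fin.ext_iff] at hj hj' hk hk'
      simp only [far (r := q) (t := j) (by lia) (by lia) (by lia),
        far (r := q') (t := j) (by lia) (by lia) (by lia), map_neg, hg]
      simp

lemma diff_braid (h : IsOddDividedDifference x s d) {p q r : Fin a}
    (hpq : (q : ℕ) = p + 1) (hqr : (r : ℕ) = q + 1) (f : R) :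
    d q (d r (d q f)) = d r (d q (d r f)) := by
  have hr := r.isLt
  induction f using h.induction_left with
  | one =>
    rw [h.diff_one q (by lia), h.diff_one r (by lia)]
    simp only [map_zero]
  | add f g hf hg => simp only [map_add, hf, hg]
  | neg f hf => simp only [map_neg, hf]
  | mul j g hg =>
    have far {r t : Fin a} (hr : 1 ≤ (r : ℕ)) (h1 : (r : ℕ) ≠ t + 1) (h2 : (t : ℕ) ≠ r)
        (g : R) : d r (x t * g) = -(x t * d r g) :=
      h.diff_far_mul hr h1 (fun e => h2 (congrArg _ e)) g
    by_cases hj : j = p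
    · subst hj
      simp only [h.diff_fst_mul hpq, h.diff_fst_mul hqr, h.diff_diff hpq, h.diff_diff hqr,
        far (r := r) (t := j) (by lia) (by lia) (by lia),
        far (r := q) (t := r) (by lia) (by lia) (by lia), map_sub, map_neg, hg]
      simp
    by_cases hj' : j = q
    · subst hj'
      simp only [h.diff_fst_mul hpq, h.diff_fst_mul hqr, h.diff_snd_mul hpq, h.diff_snd_mul hqr,
        far (r := r) (t := p) (by lia) (by lia) (by lia),
        far (r := j) (t := r) (by lia) (by lia) (by lia), map_sub, map_neg]
      rw [hg]
      abel
    by_cases hk : j = r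
    · subst hk
      simp only [h.diff_snd_mul hpq, h.diff_snd_mul hqr,
        h.diff_diff hpq, h.diff_diff hqr,
        far (r := j) (t := p) (by lia) (by lia) (by lia),
        far (r := q) (t := j) (by lia) (by lia) (by lia), map_sub, map_neg, hg]
      simp
    · rw [Fin.ext_iff] at hj hj' hk
      simp only [far (r := q) (t := j) (by lia) (by lia) (by lia),
        far (r := r) (t := j) (by lia) (by lia) (by lia), map_neg, hg]

end IsOddDividedDifference

section Monomials

variable {R ι : Type*} [Ring R]

lemma neg_one_pow_mul_eq_zsmul (n : ℕ) (f : R) : (-1 : R) ^ n * f = (-1 : ℤ) ^ n • f := by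
  simp [zsmul_eq_mul]

lemma pow_mul_pow_of_anticomm {y z : R} (h : y * z = -(z * y)) (m n : ℕ) :
    y ^ m * z ^ n = (-1 : ℤ) ^ (n * m) • (z ^ n * y ^ m) := by
  have key : ∀ m, y ^ m * z = (-1 : ℤ) ^ m • (z * y ^ m) := by
    intro m
    induction m with
    | zero => simp
    | succ m ih =>
      rw [pow_succ', mul_assoc, ih, mul_smul_comm, ← mul_assoc, h, pow_succ (-1 : ℤ), mul_smul]
      simp [mul_assoc]
  induction n with
  | zero => simp
  | succ n ih =>
    rw [pow_succ, ← mul_assoc, ih, smul_mul_assoc, mul_assoc, key, mul_smul_comm, smul_smul,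
      ← pow_add, ← mul_assoc, add_mul, one_mul]

/-- The monomial with exponents `c`, multiplied in the order of the list `l`. -/
def listMonomial (x : ι → R) (l : List ι) (c : ι → ℕ) : R := (l.map fun i => x i ^ c i).prod

@[simp]
lemma listMonomial_nil (x : ι → R) (c : ι → ℕ) : listMonomial x [] c = 1 := rfl

@[simp]
lemma listMonomial_cons (x : ι → R) (i : ι) (l : List ι) (c : ι → ℕ) :
    listMonomial x (i :: l) c = x i ^ c i * listMonomial x l c := by
  simp [listMonomial]

lemma listMonomial_append (x : ι → R) (l l' : List ι) (c : ι → ℕ) :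
    listMonomial x (l ++ l') c = listMonomial x l c * listMonomial x l' c := by
  simp [listMonomial]

lemma listMonomial_congr (x : ι → R) {l : List ι} {c c' : ι → ℕ} (h : ∀ i ∈ l, c i = c' i) :
    listMonomial x l c = listMonomial x l c' := by
  unfold listMonomial
  congr 1
  exact List.map_congr_left fun i hi => by rw [h i hi]

lemma listMonomial_mul_pow {x : ι → R} (hx : ∀ i j, i ≠ j → x i * x j = -(x j * x i))
    {l : List ι} {i : ι} (hi : i ∉ l) (c : ι → ℕ) (n : ℕ) :
    listMonomial x l c * x i ^ n =
      (-1 : ℤ) ^ (n * (l.map c).sum) • (x i ^ n * listMonomial x l c) := by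
  induction l with
  | nil => simp
  | cons j l ih =>
    rw [List.mem_cons, not_or] at hi
    rw [listMonomial_cons, mul_assoc, ih hi.2, mul_smul_comm, ← mul_assoc,
      pow_mul_pow_of_anticomm (hx j i (Ne.symm hi.1)), smul_mul_assoc, smul_smul, ← pow_add,
      mul_assoc, List.map_cons, List.sum_cons, mul_add, add_comm]

/-- The number of pairs of factors transposed in reordering the product of the monomials with
exponents `c` and `c'`. -/
def reorderCount (c c' : ι → ℕ) : List ι → ℕ
  | [] => 0
  | i :: l => c' i * (l.map c).sum + reorderCount c c' l

lemma listMonomial_mul_listMonomial {x : ι → R} (hx : ∀ i j, i ≠ j → x i * x j = -(x j * x i))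
    {l : List ι} (hl : l.Nodup) (c c' : ι → ℕ) :
    listMonomial x l c * listMonomial x l c' =
      (-1 : ℤ) ^ reorderCount c c' l • listMonomial x l (c + c') := by
  induction l with
  | nil => simp [reorderCount]
  | cons i l ih =>
    rw [List.nodup_cons] at hl
    rw [listMonomial_cons, listMonomial_cons, mul_assoc, ← mul_assoc _ (x i ^ c' i),
      listMonomial_mul_pow hx hl.1, smul_mul_assoc, mul_assoc, ih hl.2, mul_smul_comm,
      mul_smul_comm, mul_smul_comm, smul_smul, ← pow_add, listMonomial_cons, Pi.add_apply,
      pow_add (x i), mul_assoc, reorderCount]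

lemma reorderCount_eq_sum [LinearOrder ι] {l : List ι} (hl : l.Pairwise (· < ·)) (c c' : ι → ℕ) :
    reorderCount c c' l = ∑ i ∈ l.toFinset, c' i * ∑ j ∈ l.toFinset with i < j, c j := by
  induction l with
  | nil => simp [reorderCount]
  | cons i l ih =>
    rw [List.pairwise_cons] at hl
    have hi : i ∉ l.toFinset := fun h => lt_irrefl i (hl.1 i (List.mem_toFinset.1 h))
    have hnd : l.Nodup := hl.2.imp ne_of_lt
    rw [reorderCount, ih hl.2, List.toFinset_cons, Finset.sum_insert hi, Finset.filter_insert,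
      if_neg (lt_irrefl i), Finset.filter_true_of_mem fun j hj => hl.1 j (List.mem_toFinset.1 hj),
      List.sum_toFinset c hnd]
    congr 1
    refine Finset.sum_congr rfl fun j hj => ?_
    rw [Finset.filter_insert, if_neg (hl.1 j (List.mem_toFinset.1 hj)).not_gt]

lemma listMonomial_finRange_mul {a : ℕ} {x : Fin a → R}
    (hx : ∀ i j, i ≠ j → x i * x j = -(x j * x i)) (c c' : Fin a → ℕ) :
    listMonomial x (List.finRange a) c * listMonomial x (List.finRange a) c' =
      (-1 : ℤ) ^ (∑ i, c' i * ∑ j with i < j, c j) •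
        listMonomial x (List.finRange a) (c + c') := by
  rw [listMonomial_mul_listMonomial hx (List.nodup_finRange a),
    reorderCount_eq_sum (List.pairwise_lt_finRange a), List.toFinset_finRange]

/-- The elementary symmetric expression of degree `k` in the elements `y i`, `i ∈ l`, with the
factors multiplied in the order of the list `l`. -/
def listEsymm (y : ι → R) : List ι → ℕ → R
  | [], 0 => 1
  | [], _ + 1 => 0
  | _ :: l, 0 => listEsymm y l 0
  | i :: l, k + 1 => y i * listEsymm y l k + listEsymm y l (k + 1)

lemma listEsymm_eq_sum [DecidableEq ι] (x : ι → R) (w : ι → ℕ) {l : List ι} (hl : l.Nodup)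
    (k : ℕ) :
    listEsymm (fun i => (-1 : ℤ) ^ w i • x i) l k =
      ∑ I ∈ l.toFinset.powersetCard k,
        (-1 : ℤ) ^ (∑ i ∈ I, w i) • listMonomial x l fun i => if i ∈ I then 1 else 0 := by
  induction l generalizing k with
  | nil =>
    cases k with
    | zero => simp [listEsymm]
    | succ k => rw [listEsymm, List.toFinset_nil, Finset.powersetCard_eq_empty.2 (by simp),
        Finset.sum_empty]
  | cons i l ih =>
    rw [List.nodup_cons] at hl
    have hi : i ∉ l.toFinset := fun h => hl.1 (List.mem_toFinset.1 h)
    cases k with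
    | zero =>
      rw [listEsymm, ih hl.2]
      simp
    | succ k =>
      rw [listEsymm, ih hl.2, ih hl.2, List.toFinset_cons, Finset.powersetCard_succ_insert hi,
        Finset.sum_union, Finset.sum_image, add_comm, Finset.mul_sum]
      · congr 1
        · refine Finset.sum_congr rfl fun I hI => ?_
          have hI' : i ∉ I := fun h => hi ((Finset.mem_powersetCard.1 hI).1 h)
          simp [hI']
        · refine Finset.sum_congr rfl fun I hI => ?_
          have hI' : i ∉ I := fun h => hi ((Finset.mem_powersetCard.1 hI).1 h)
          rw [listMonomial_cons, Finset.sum_insert hI', if_pos (Finset.mem_insert_self i I),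
            pow_one, mul_smul_comm, smul_mul_assoc, smul_smul, ← pow_add, add_comm]
          congr 2
          refine listMonomial_congr x fun j hj => ?_
          have : j ≠ i := fun e => hl.1 (e ▸ hj)
          simp [this]
      · intro I hI J hJ hIJ
        have hI' : i ∉ I := fun h => hi ((Finset.mem_powersetCard.1 hI).1 h)
        have hJ' : i ∉ J := fun h => hi ((Finset.mem_powersetCard.1 hJ).1 h)
        rw [← Finset.erase_insert hI', hIJ, Finset.erase_insert hJ']
      · rw [Finset.disjoint_left]
        intro I hI hI'
        obtain ⟨J, -, rfl⟩ := Finset.mem_image.1 hI'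
        exact hi ((Finset.mem_powersetCard.1 hI).1 (Finset.mem_insert_self i J))

end Monomials

lemma exists_finRange_eq_append {a : ℕ} {p q : Fin a} (hpq : (q : ℕ) = p + 1) :
    ∃ l₁ l₂ : List (Fin a), List.finRange a = l₁ ++ p :: q :: l₂ ∧
      l₁.map Fin.val = List.range p ∧ (∀ j ∈ l₁, j ≠ p ∧ j ≠ q) ∧ ∀ j ∈ l₂, j ≠ p ∧ j ≠ q := by
  have hq := q.isLt
  have hsplit : List.finRange a =
      (List.finRange a).take p ++ p :: q :: (List.finRange a).drop (p + 2) := by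
    have h1 := List.cons_getElem_drop_succ (l := List.finRange a) (n := p) (h := by simp)
    have h2 := List.cons_getElem_drop_succ (l := List.finRange a) (n := p + 1) (h := by simp; lia)
    conv_lhs => rw [← List.take_append_drop p (List.finRange a), ← h1, ← h2]
    congr 3
    · simp
    · ext
      simp [hpq]
  refine ⟨_, _, hsplit, ?_, ?_⟩
  · rw [List.map_take, List.map_coe_finRange_eq_range, List.take_range, min_eq_left p.isLt.le]
  · have hnd := hsplit ▸ List.nodup_finRange a
    rw [List.nodup_append] at hnd
    obtain ⟨-, h2, h3⟩ := hnd
    simp only [List.nodup_cons, List.mem_cons, not_or] at h2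
    refine ⟨fun j hj => ⟨h3 j hj p (by simp), h3 j hj q (by simp)⟩, fun j hj => ⟨?_, ?_⟩⟩
    · rintro rfl
      exact h2.1.2 hj
    · rintro rfl
      exact h2.2.1 hj

section DivDiffWord

variable {R : Type*} [Ring R]

/-- Composite of the operators `d i` along a word, leftmost letter acting last. -/
def divDiffWord (d : ℕ → R →+ R) : List ℕ → (R →+ R)
  | [] => AddMonoidHom.id _
  | i :: l => (d i).comp (divDiffWord d l)

lemma divDiffWord_append (d : ℕ → R →+ R) (l l' : List ℕ) (f : R) :
    divDiffWord d (l ++ l') f = divDiffWord d l (divDiffWord d l' f) := by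
  induction l with
  | nil => rfl
  | cons i l ih => exact congrArg (d i) ih

/-- The word `n, n - 1, …, 1`. -/
def descendingWord (n : ℕ) : List ℕ := (List.range n).reverse.map (· + 1)

lemma descendingWord_succ (n : ℕ) : descendingWord (n + 1) = (n + 1) :: descendingWord n := by
  simp [descendingWord, List.range_succ]

lemma DList_succ (n : ℕ) : DList (n + 1) = DList n ++ descendingWord n := by
  simp [DList, descendingWord, List.range_succ]

end DivDiffWord

namespace IsOddDividedDifference

variable {R : Type*} [Ring R] {a : ℕ} {x : Fin a → R} {s : ℕ → R →+* R} {d : ℕ → R →+ R}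

lemma diff_listMonomial_mul (h : IsOddDividedDifference x s d) {p q : Fin a}
    (hpq : (q : ℕ) = p + 1) {l : List (Fin a)} (hl : ∀ j ∈ l, j ≠ p ∧ j ≠ q) (c : Fin a → ℕ)
    (g : R) :
    d q (listMonomial x l c * g) =
      (-1 : ℤ) ^ (l.map c).sum • (listMonomial x l c * d q g) := by
  induction l with
  | nil => simp
  | cons j l ih =>
    rw [List.forall_mem_cons] at hl
    have hj : (q : ℕ) ≠ j + 1 := fun e => hl.1.1 (Fin.ext (by lia))
    have key : ∀ n f, d q (x j ^ n * f) = (-1 : ℤ) ^ n • (x j ^ n * d q f) := by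
      intro n f
      induction n with
      | zero => simp
      | succ n ihn =>
        rw [pow_succ', mul_assoc, h.diff_far_mul (by lia) hj hl.1.2, ihn, mul_smul_comm, pow_succ']
        simp [mul_assoc]
    rw [listMonomial_cons, mul_assoc, key, ih hl.2, mul_smul_comm, smul_smul, ← pow_add,
      mul_assoc, List.map_cons, List.sum_cons]

lemma diff_listMonomial_eq_zero (h : IsOddDividedDifference x s d) {p q : Fin a}
    (hpq : (q : ℕ) = p + 1) {l : List (Fin a)} (hl : ∀ j ∈ l, j ≠ p ∧ j ≠ q) (c : Fin a → ℕ) :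
    d q (listMonomial x l c) = 0 := by
  simpa [h.diff_one q (by lia)] using h.diff_listMonomial_mul hpq hl c 1

lemma diff_pow_mul_pow_mul (h : IsOddDividedDifference x s d) {p q : Fin a}
    (hpq : (q : ℕ) = p + 1) (n : ℕ) {g : R} (hg : d q g = 0) :
    d q (x p ^ n * (x q ^ n * g)) = 0 := by
  induction n with
  | zero => simpa
  | succ n ih =>
    have hne : p ≠ q := fun e => by simp [e] at hpq
    have hcomm := pow_mul_pow_of_anticomm (h.anticomm p q hne) n 1
    rw [pow_one] at hcomm
    have hrw : x p ^ (n + 1) * (x q ^ (n + 1) * g) =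
        (-1 : ℤ) ^ (1 * n) • (x p * (x q * (x p ^ n * (x q ^ n * g)))) := by
      rw [pow_succ', pow_succ' (x q), mul_assoc, mul_assoc (x q), ← mul_assoc (x p ^ n), hcomm,
        smul_mul_assoc, mul_smul_comm, mul_assoc (x q)]
    rw [hrw, map_zsmul, h.diff_fst_mul hpq, h.diff_snd_mul hpq, ih]
    simp

/-- A monomial with equal exponents at two neighbouring variables is killed by the
corresponding divided difference. -/
lemma diff_monomial_of_eq (h : IsOddDividedDifference x s d) {p q : Fin a}
    (hpq : (q : ℕ) = p + 1) {c : Fin a → ℕ} (hc : c p = c q) :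
    d q (listMonomial x (List.finRange a) c) = 0 := by
  obtain ⟨l₁, l₂, hl, -, h₁, h₂⟩ := exists_finRange_eq_append hpq
  rw [hl, listMonomial_append, h.diff_listMonomial_mul hpq h₁, listMonomial_cons,
    listMonomial_cons, hc, h.diff_pow_mul_pow_mul hpq _ (h.diff_listMonomial_eq_zero hpq h₂ c)]
  simp

lemma diff_monomial_of_eq_add_one (h : IsOddDividedDifference x s d) {p q : Fin a}
    (hpq : (q : ℕ) = p + 1) {c c' : ℕ → ℕ} (hc : c p = c q + 1) (hc' : c' p = c q)
    (hcc' : ∀ j ≠ (p : ℕ), c' j = c j) :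
    d q (listMonomial x (List.finRange a) fun i => c i) =
      (-1 : ℤ) ^ (∑ i ∈ Finset.range p, c i) •
        listMonomial x (List.finRange a) fun i => c' i := by
  obtain ⟨l₁, l₂, hl, hsum, h₁, h₂⟩ := exists_finRange_eq_append hpq
  have hzero := h.diff_pow_mul_pow_mul hpq (c q)
    (h.diff_listMonomial_eq_zero hpq h₂ fun i => c i)
  have e₁ : (l₁.map fun i : Fin a => c i).sum = ∑ i ∈ Finset.range p, c i := by
    change (l₁.map (c ∘ Fin.val)).sum = _
    rw [← List.map_map (f := Fin.val) (g := c), hsum]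
    rfl
  have e₂ : listMonomial x l₁ (fun i => c' i) = listMonomial x l₁ fun i => c i :=
    listMonomial_congr x fun j hj => hcc' _ fun e => (h₁ j hj).1 (Fin.ext e)
  have e₃ : listMonomial x l₂ (fun i => c' i) = listMonomial x l₂ fun i => c i :=
    listMonomial_congr x fun j hj => hcc' _ fun e => (h₂ j hj).1 (Fin.ext e)
  rw [hl, listMonomial_append, listMonomial_append, h.diff_listMonomial_mul hpq h₁, e₁, e₂,
    listMonomial_cons, listMonomial_cons, listMonomial_cons, listMonomial_cons, e₃, hc, hc',
    hcc' q (by lia), pow_succ', mul_assoc, h.diff_fst_mul hpq, hzero, mul_zero, sub_zero]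

lemma diff_listEsymm (h : IsOddDividedDifference x s d) {p q : Fin a} (hpq : (q : ℕ) = p + 1)
    (k : ℕ) :
    d q (listEsymm (fun i : Fin a => (-1 : ℤ) ^ (i : ℕ) • x i) (List.finRange a) k) = 0 := by
  obtain ⟨l₁, l₂, hl, -, h₁, h₂⟩ := exists_finRange_eq_append hpq
  set y : Fin a → R := fun i => (-1 : ℤ) ^ (i : ℕ) • x i with hy
  have far : ∀ (j : Fin a) (g : R), j ≠ p ∧ j ≠ q → d q g = 0 → d q (y j * g) = 0 := by
    intro j g hj hg
    have hj' : (q : ℕ) ≠ j + 1 := fun e => hj.1 (Fin.ext (by lia))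
    rw [hy, smul_mul_assoc, map_zsmul, h.diff_far_mul (by lia) hj' hj.2, hg]
    simp
  have h₂' : ∀ k, d q (listEsymm y l₂ k) = 0 := by
    clear hl
    induction l₂ with
    | nil =>
      rintro (_ | k)
      · exact h.diff_one q (by lia)
      · exact map_zero _
    | cons j l ih =>
      rw [List.forall_mem_cons] at h₂
      rintro (_ | k)
      · exact ih h₂.2 0
      · rw [listEsymm, map_add, far j _ h₂.1 (ih h₂.2 k), ih h₂.2, add_zero]
  have single : ∀ g, d q g = 0 → d q (y p * g) + d q (y q * g) = 0 := by
    intro g hg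
    rw [hy, smul_mul_assoc, smul_mul_assoc, map_zsmul, map_zsmul, h.diff_fst_mul hpq,
      h.diff_snd_mul hpq, hg, hpq, pow_succ]
    simp
  have double : ∀ g, d q g = 0 → d q (y p * (y q * g)) = 0 := by
    intro g hg
    have := h.diff_pow_mul_pow_mul hpq 1 hg
    rw [pow_one, pow_one] at this
    rw [hy, smul_mul_assoc, smul_mul_assoc, mul_smul_comm, map_zsmul, map_zsmul, this]
    simp
  rw [hl]
  clear hl
  induction l₁ generalizing k with
  | nil =>
    rcases k with _ | _ | k
    · exact h₂' 0
    · simp only [List.nil_append, listEsymm, map_add, h₂', single, add_zero, ← add_assoc]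
    · simp only [List.nil_append, listEsymm, map_add, mul_add, double, h₂', add_zero, zero_add,
        ← add_assoc, single]
  | cons j l ih =>
    rw [List.forall_mem_cons] at h₁
    rcases k with _ | k
    · exact ih 0 h₁.2
    · rw [List.cons_append, listEsymm, map_add, far j _ h₁.1 (ih k h₁.2), ih (k + 1) h₁.2, add_zero]

lemma divDiffWord_mul (h : IsOddDividedDifference x s d) {l : List ℕ}
    (hl : ∀ i ∈ l, 1 ≤ i ∧ i < a) {e : R} (he : ∀ q : Fin a, 1 ≤ (q : ℕ) → d q e = 0) (f : R) :
    divDiffWord d l (f * e) = divDiffWord d l f * e := by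
  induction l with
  | nil => rfl
  | cons i l ih =>
    rw [List.forall_mem_cons] at hl
    have hi := h.diff_mul_of_diff_eq_zero (q := ⟨i, hl.1.2⟩) hl.1.1 (he _ hl.1.1)
    change d i (divDiffWord d l (f * e)) = d i (divDiffWord d l f) * e
    rw [ih hl.2, hi]

lemma diff_descendingWord_of_lt (h : IsOddDividedDifference x s d) {n m : ℕ} (hnm : n + 1 < m)
    (hm : m < a) {f : R} (hf : d m f = 0) : d m (divDiffWord d (descendingWord n) f) = 0 := by
  induction n with
  | zero => exact hf
  | succ n ih =>
    have hc := h.diff_anticomm (p := ⟨n, by lia⟩) (q := ⟨n + 1, by lia⟩) (p' := ⟨m - 1, by lia⟩)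
      (q' := ⟨m, hm⟩) rfl (by simp; lia) (by simp; lia) (divDiffWord d (descendingWord n) f)
    rw [descendingWord_succ]
    change d m (d (n + 1) (divDiffWord d (descendingWord n) f)) = 0
    simp only [ih (by lia), map_zero] at hc
    rw [← neg_eq_zero, ← hc]

lemma diff_descendingWord (h : IsOddDividedDifference x s d) {n m : ℕ} (hm : 1 ≤ m)
    (hmn : m + 1 ≤ n) (hn : n < a) {f : R} (hf : d (m + 1) f = 0) :
    d m (divDiffWord d (descendingWord n) f) = 0 := by
  induction n, hmn using Nat.le_induction with
  | base =>
    obtain ⟨m, rfl⟩ := Nat.exists_eq_add_of_le' hm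
    have hb := h.diff_braid (p := ⟨m, by lia⟩) (q := ⟨m + 1, by lia⟩) (r := ⟨m + 2, by lia⟩)
      rfl rfl (divDiffWord d (descendingWord m) f)
    rw [descendingWord_succ, descendingWord_succ]
    change d (m + 1) (d (m + 1 + 1) (d (m + 1) (divDiffWord d (descendingWord m) f))) = 0
    refine hb.trans ?_
    simp only [h.diff_descendingWord_of_lt (n := m) (by lia) hn hf, map_zero]
  | succ n hmn ih =>
    have hc := h.diff_anticomm (p := ⟨m - 1, by lia⟩) (q := ⟨m, by lia⟩) (p' := ⟨n, by lia⟩)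
      (q' := ⟨n + 1, hn⟩) (by simp; lia) rfl hmn (divDiffWord d (descendingWord n) f)
    rw [descendingWord_succ]
    refine hc.trans ?_
    simp only [ih (by lia), map_zero, neg_zero]

lemma divDiffWord_DList_eq_zero (h : IsOddDividedDifference x s d) {n m : ℕ} (hn : n ≤ a)
    (hm : 1 ≤ m) (hmn : m < n) {f : R} (hf : d m f = 0) : divDiffWord d (DList n) f = 0 := by
  induction n generalizing m f with
  | zero => lia
  | succ n ih =>
    rw [DList_succ, divDiffWord_append]
    obtain rfl | ⟨m, rfl⟩ : m = 1 ∨ ∃ k, m = k + 2 := by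
      rcases m with _ | _ | m <;> simp at hm ⊢
    · have key : ∀ k, divDiffWord d (descendingWord (k + 1)) f = 0 := by
        intro k
        induction k with
        | zero => exact hf
        | succ k ihk =>
          rw [descendingWord_succ]
          exact (congrArg (d _) ihk).trans (map_zero _)
      obtain ⟨k, rfl⟩ : ∃ k, n = k + 1 := ⟨n - 1, by lia⟩
      rw [key, map_zero]
    · exact ih (by lia) (by lia) (by lia)
        (h.diff_descendingWord (m := m + 1) (by lia) (by lia) (by lia) hf)

end IsOddDividedDifference

section Counting

lemma sum_range_sum_range_staircase_even_iff (b : ℕ) :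
    Even (∑ t ∈ Finset.range b, ∑ i ∈ Finset.range t, (b - 1 - i)) ↔ Even (b.choose 2) := by
  induction b with
  | zero => simp
  | succ b ih =>
    have hrec : ∑ t ∈ Finset.range (b + 1), ∑ i ∈ Finset.range t, (b + 1 - 1 - i) =
        ∑ t ∈ Finset.range b, ∑ i ∈ Finset.range t, (b - 1 - i) + b * b := by
      rw [Finset.sum_range_succ']
      simp only [Finset.sum_range_succ', Finset.sum_add_distrib, Finset.sum_range_zero]
      simp [Nat.sub_sub, add_comm]
    rw [hrec, Nat.even_add, ih, Nat.choose_succ_succ' b 1, Nat.choose_one_right, Nat.even_add,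
      Nat.even_mul, or_self]
    tauto

variable {a : ℕ}

/-- The number of transpositions needed to sort the product of the ordered monomials with
exponents `c` and `c'`. -/
def sortCount (c c' : Fin a → ℕ) : ℕ := ∑ i, c' i * ∑ j with i < j, c j

lemma sortCount_add_left (c₁ c₂ c' : Fin a → ℕ) :
    sortCount (c₁ + c₂) c' = sortCount c₁ c' + sortCount c₂ c' := by
  simp [sortCount, Finset.sum_add_distrib, mul_add]

/-- The exponent vector of the squarefree monomial with support `I`. -/
def indicatorExp (I : Finset (Fin a)) : Fin a → ℕ := fun j => if j ∈ I then 1 else 0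

lemma sortCount_indicatorExp_right (c : Fin a → ℕ) (I : Finset (Fin a)) :
    sortCount c (indicatorExp I) = ∑ i ∈ I, ∑ j with i < j, c j := by
  simp [sortCount, indicatorExp]

lemma sortCount_indicatorExp_left (c : Fin a → ℕ) (I : Finset (Fin a)) :
    sortCount (indicatorExp I) c = ∑ i ∈ I, ∑ j with j < i, c j := by
  simp only [sortCount, indicatorExp, Finset.mul_sum, Finset.sum_filter]
  rw [Finset.sum_comm, ← Finset.sum_filter_add_sum_filter_not _ (· ∈ I)]
  simp +contextual [Finset.sum_ite]

lemma sortCount_indicatorExp_add (c : Fin a → ℕ) (I : Finset (Fin a)) :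
    sortCount c (indicatorExp I) + sortCount (indicatorExp I) c + ∑ i ∈ I, c i =
      I.card * ∑ i, c i := by
  rw [sortCount_indicatorExp_left, sortCount_indicatorExp_right, ← Finset.sum_add_distrib,
    ← Finset.sum_add_distrib, ← smul_eq_mul, ← Finset.sum_const]
  refine Finset.sum_congr rfl fun i _ => ?_
  have hi : c i = ∑ j, if j = i then c j else 0 := by simp
  rw [Finset.sum_filter, Finset.sum_filter, hi, ← Finset.sum_add_distrib, ← Finset.sum_add_distrib]
  refine Finset.sum_congr rfl fun j _ => ?_
  rcases lt_trichotomy i j with h | h | h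
  · simp [h, h.not_gt, h.ne']
  · simp [h]
  · simp [h, h.not_gt, h.ne]

lemma eq_filter_of_antitone_indicatorExp {k : ℕ} {I : Finset (Fin a)} (hI : I.card = k)
    (h : Antitone (indicatorExp I)) : I = Finset.univ.filter fun i : Fin a => (i : ℕ) < k := by
  have hka : k ≤ a := by simpa [hI] using I.card_le_univ
  have hcard : (Finset.univ.filter fun i : Fin a => (i : ℕ) < k).card = k := by
    rw [Fin.card_filter_val_lt, min_eq_right hka]
  refine (Finset.eq_of_subset_of_card_le (fun j hj => ?_) (by rw [hcard, hI])).symm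
  by_contra hjI
  have hsub : I ⊆ Finset.univ.filter fun i : Fin a => (i : ℕ) < j := by
    intro i hi
    rw [Finset.mem_filter]
    refine ⟨Finset.mem_univ i, lt_of_not_ge fun hji => ?_⟩
    have := h (Fin.le_def.2 hji)
    simp [indicatorExp, hi, hjI] at this
  have h1 := Finset.card_le_card hsub
  rw [Fin.card_filter_val_lt, hI] at h1
  have h2 := (Finset.mem_filter.1 hj).2
  lia

lemma antitone_indicatorExp_filter (k : ℕ) :
    Antitone (indicatorExp (Finset.univ.filter fun i : Fin a => (i : ℕ) < k)) := by
  intro i j hij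
  simp only [indicatorExp, Finset.mem_filter, Finset.mem_univ, true_and]
  rw [Fin.le_def] at hij
  split_ifs <;> lia

/-- The exponents of the staircase monomial. -/
def staircase (a : ℕ) : Fin a → ℕ := fun i => a - 1 - i

end Counting

namespace IsOddDividedDifference

variable {R : Type*} [Ring R] {a : ℕ} {x : Fin a → R} {s : ℕ → R →+* R} {d : ℕ → R →+ R}

lemma divDiffWord_descendingWord_staircase (h : IsOddDividedDifference x s d) {b j : ℕ}
    (hj : j ≤ b) (hb : b < a) :
    divDiffWord d (descendingWord j) (listMonomial x (List.finRange a) fun i => b - i) =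
      (-1 : ℤ) ^ (∑ t ∈ Finset.range j, ∑ i ∈ Finset.range t, (b - 1 - i)) •
        listMonomial x (List.finRange a) fun i => if (i : ℕ) < j then b - 1 - i else b - i := by
  induction j with
  | zero => simp [descendingWord, divDiffWord]
  | succ j ih =>
    have hd := h.diff_monomial_of_eq_add_one (p := ⟨j, by lia⟩) (q := ⟨j + 1, by lia⟩) rfl
      (c := fun i => if i < j then b - 1 - i else b - i)
      (c' := fun i => if i < j + 1 then b - 1 - i else b - i)
      (by simp; lia) (by simp; lia)
      (by intro i hi; simp only [ne_eq] at hi; split_ifs <;> lia)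
    have hs : ∑ i ∈ Finset.range j, (if i < j then b - 1 - i else b - i) =
        ∑ i ∈ Finset.range j, (b - 1 - i) :=
      Finset.sum_congr rfl fun i hi => if_pos (Finset.mem_range.1 hi)
    rw [descendingWord_succ]
    change d (j + 1) (divDiffWord d (descendingWord j) _) = _
    rw [ih (by lia), map_zsmul]
    dsimp only at hd
    rw [hd, hs, smul_smul, ← pow_add, Finset.sum_range_succ]

lemma divDiffWord_DList_staircase (h : IsOddDividedDifference x s d) {n : ℕ} (hn : n ≤ a) :
    divDiffWord d (DList n) (listMonomial x (List.finRange a) fun i => n - 1 - i) =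
      (-1 : ℤ) ^ n.choose 3 • 1 := by
  induction n with
  | zero => simp [DList, divDiffWord, listMonomial]
  | succ n ih =>
    rw [DList_succ, divDiffWord_append, Nat.add_sub_cancel,
      h.divDiffWord_descendingWord_staircase le_rfl hn, map_zsmul,
      listMonomial_congr x (c' := fun i : Fin a => n - 1 - i) (by intro i _; split_ifs <;> lia),
      ih (by lia), smul_smul, Nat.choose_succ_succ' n 2, pow_add,
      neg_one_pow_congr (sum_range_sum_range_staircase_even_iff n)]

/-- The product of a sorted monomial, the staircase monomial and the odd elementary symmetric
polynomial. -/
lemma monomial_mul_staircase_mul_listEsymm (h : IsOddDividedDifference x s d) (α : Fin a → ℕ)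
    (k : ℕ) :
    listMonomial x (List.finRange a) α * listMonomial x (List.finRange a) (staircase a) *
        listEsymm (fun i : Fin a => (-1 : ℤ) ^ (i : ℕ) • x i) (List.finRange a) k =
      (-1 : ℤ) ^ (k * (∑ i, staircase a i + (a - 1))) •
        ∑ I ∈ Finset.univ.powersetCard k,
          (-1 : ℤ) ^ (∑ i ∈ I, ∑ j with i < j, α j) •
            (listMonomial x (List.finRange a) (α + indicatorExp I) *
              listMonomial x (List.finRange a) (staircase a)) := by
  rw [listEsymm_eq_sum x _ (List.nodup_finRange a), List.toFinset_finRange, Finset.mul_sum,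
    Finset.smul_sum]
  refine Finset.sum_congr rfl fun I hI => ?_
  have hk : I.card = k := (Finset.mem_powersetCard.1 hI).2
  change _ * ((-1 : ℤ) ^ (∑ i ∈ I, (i : ℕ)) • listMonomial x _ (indicatorExp I)) = _
  have mul : ∀ c c' : Fin a → ℕ,
      listMonomial x (List.finRange a) c * listMonomial x (List.finRange a) c' =
        (-1 : ℤ) ^ sortCount c c' • listMonomial x (List.finRange a) (c + c') :=
    listMonomial_finRange_mul h.anticomm
  rw [mul_smul_comm, mul, smul_mul_assoc, mul, mul, smul_smul, smul_smul, smul_smul, smul_smul,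
    ← pow_add, ← pow_add, ← pow_add, ← pow_add, add_right_comm α]
  congr 1
  have h₁ := sortCount_indicatorExp_add (staircase a) I
  have h₂ : ∑ i ∈ I, (i : ℕ) + ∑ i ∈ I, staircase a i = I.card * (a - 1) := by
    rw [← Finset.sum_add_distrib, ← smul_eq_mul, ← Finset.sum_const]
    refine Finset.sum_congr rfl fun i _ => ?_
    have := i.isLt
    simp only [staircase]
    lia
  rw [hk] at h₁ h₂
  refine neg_one_pow_congr ?_
  rw [sortCount_add_left, sortCount_add_left, sortCount_indicatorExp_right α, mul_add, ← h₁, ← h₂]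
  grind

/-- The odd Schur polynomial with exponents `α`, for a substitution homomorphism `W`. -/
def schur (x : Fin a → R) (d : ℕ → R →+ R) (W : R →+* R) (α : Fin a → ℕ) : R :=
  (-1 : ℤ) ^ a.choose 3 • W (divDiffWord d (DList a)
    (listMonomial x (List.finRange a) α * listMonomial x (List.finRange a) (staircase a)))

lemma schur_zero (h : IsOddDividedDifference x s d) (W : R →+* R) : schur x d W 0 = 1 := by
  have h0 : listMonomial x (List.finRange a) 0 = 1 := by simp [listMonomial]
  have hδ := h.divDiffWord_DList_staircase le_rfl
  change divDiffWord d (DList a) (listMonomial x (List.finRange a) (staircase a)) = _ at hδ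
  rw [schur, h0, one_mul, hδ, map_zsmul, map_one, smul_smul, ← pow_add, Even.neg_one_pow ⟨_, rfl⟩,
    one_smul]

lemma schur_eq_zero (h : IsOddDividedDifference x s d) (W : R →+* R) {c : Fin a → ℕ}
    {p q : Fin a} (hpq : (q : ℕ) = p + 1) (hc : c q = c p + 1) : schur x d W c = 0 := by
  have hq := q.isLt
  have heq : (c + staircase a) p = (c + staircase a) q := by
    simp only [Pi.add_apply, staircase]
    lia
  rw [schur, listMonomial_finRange_mul h.anticomm, map_zsmul,
    h.divDiffWord_DList_eq_zero le_rfl (by lia) hq (h.diff_monomial_of_eq hpq heq)]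
  simp

lemma schur_add_indicatorExp_eq_zero (h : IsOddDividedDifference x s d) (W : R →+* R)
    {α : Fin a → ℕ} (hα : Antitone α) {I : Finset (Fin a)}
    (hI : ¬ Antitone (α + indicatorExp I)) : schur x d W (α + indicatorExp I) = 0 := by
  obtain ⟨p, q, hpq, hlt⟩ : ∃ p q : Fin a, (q : ℕ) = p + 1 ∧
      (α + indicatorExp I) p < (α + indicatorExp I) q := by
    contrapose! hI
    rcases a with _ | n
    · exact Subsingleton.antitone _
    · exact Fin.antitone_iff_succ_le.2 fun i => hI i.castSucc i.succ (by simp)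
  refine h.schur_eq_zero W hpq ?_
  have := hα (Fin.le_def.2 (by lia : (p : ℕ) ≤ q))
  simp only [Pi.add_apply, indicatorExp] at hlt ⊢
  split_ifs at hlt ⊢ <;> lia

open Classical in
lemma schur_mul_map_listEsymm (h : IsOddDividedDifference x s d) (W : R →+* R) {α : Fin a → ℕ}
    (hα : Antitone α) (k : ℕ) :
    schur x d W α *
        W (listEsymm (fun i : Fin a => (-1 : ℤ) ^ (i : ℕ) • x i) (List.finRange a) k) =
      (-1 : ℤ) ^ (k * (∑ i, staircase a i + (a - 1))) •
        ∑ I ∈ Finset.univ.powersetCard k,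
          if Antitone (α + indicatorExp I) then
            (-1 : ℤ) ^ (∑ i ∈ I, ∑ j with i < j, α j) • schur x d W (α + indicatorExp I)
          else 0 := by
  have hker : ∀ q : Fin a, 1 ≤ (q : ℕ) →
      d q (listEsymm (fun i : Fin a => (-1 : ℤ) ^ (i : ℕ) • x i) (List.finRange a) k) = 0 :=
    fun q hq => h.diff_listEsymm (p := ⟨q - 1, by lia⟩) (by simp; lia) k
  have hlist : ∀ i ∈ DList a, 1 ≤ i ∧ i < a := by
    intro i hi
    simp only [DList, List.mem_flatten, List.mem_map, List.mem_range] at hi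
    obtain ⟨_, ⟨b, hb, rfl⟩, hi⟩ := hi
    simp only [List.mem_map, List.mem_reverse, List.mem_range] at hi
    lia
  rw [schur, smul_mul_assoc, ← map_mul, ← h.divDiffWord_mul hlist hker,
    h.monomial_mul_staircase_mul_listEsymm, map_zsmul, map_zsmul, smul_comm, map_sum, map_sum,
    Finset.smul_sum]
  congr 1
  refine Finset.sum_congr rfl fun I _ => ?_
  rw [map_zsmul, map_zsmul, smul_comm]
  change _ • schur x d W (α + indicatorExp I) = _
  split_ifs with hI
  · rfl
  · rw [h.schur_add_indicatorExp_eq_zero W hα hI, smul_zero]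

open Classical in
lemma schur_mul_schur_column (h : IsOddDividedDifference x s d) (W : R →+* R) {α : Fin a → ℕ}
    (hα : Antitone α) {k : ℕ} (hk : k ≤ a) :
    schur x d W α * schur x d W (fun i => if (i : ℕ) < k then 1 else 0) =
      ∑ I ∈ Finset.univ.powersetCard k,
        if Antitone (α + indicatorExp I) then
          (-1 : ℤ) ^ (∑ i ∈ I, ∑ j with i < j, α j) • schur x d W (α + indicatorExp I)
        else 0 := by
  set C := Finset.univ.filter fun i : Fin a => (i : ℕ) < k
  have hC : indicatorExp C = fun i : Fin a => if (i : ℕ) < k then 1 else 0 := by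
    ext i
    simp [indicatorExp, C]
  have hcol := h.schur_mul_map_listEsymm W (α := 0) (fun _ _ _ => le_rfl) k
  rw [Finset.sum_eq_single C] at hcol
  rotate_left
  · intro I hI hne
    refine if_neg fun hanti => hne ?_
    rw [zero_add] at hanti
    exact eq_filter_of_antitone_indicatorExp (Finset.mem_powersetCard.1 hI).2 hanti
  · intro hmem
    refine absurd (Finset.mem_powersetCard.2 ⟨Finset.subset_univ _, ?_⟩) hmem
    rw [Fin.card_filter_val_lt, min_eq_right hk]
  rw [zero_add, if_pos (antitone_indicatorExp_filter k), h.schur_zero, one_mul] at hcol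
  have hmain := h.schur_mul_map_listEsymm W hα k
  rw [hcol, mul_smul_comm] at hmain
  simp only [Pi.zero_apply, Finset.sum_const_zero, pow_zero, one_smul, hC] at hmain
  have := congrArg ((-1 : ℤ) ^ (k * (∑ i, staircase a i + (a - 1))) • ·) hmain
  simpa only [smul_smul, ← pow_add, Even.neg_one_pow ⟨_, rfl⟩, one_smul] using this

end IsOddDividedDifference

section OddPolynomials

variable {a : ℕ}

lemma xv_succ (i : Fin a) : xv a (i + 1) = OX i := by
  simp [xv]

lemma OX_mul_OX_of_ne {i j : Fin a} (hij : i ≠ j) : (OX i * OX j : OPol a) = -(OX j * OX i) := by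
  have := RingQuot.mkRingHom_rel (OddRel.anticomm i j hij)
  rwa [map_neg, map_mul, map_mul] at this

lemma closure_range_OX : Subring.closure (Set.range (OX : Fin a → OPol a)) = ⊤ := by
  refine eq_top_iff.2 fun f _ => ?_
  obtain ⟨g, rfl⟩ := RingQuot.mkRingHom_surjective (OddRel a) f
  induction g using FreeAlgebra.induction with
  | grade0 n =>
    rw [eq_intCast, map_intCast]
    exact intCast_mem _ n
  | grade1 i => exact Subring.subset_closure ⟨i, rfl⟩
  | mul f g hf hg =>
    rw [map_mul]
    exact mul_mem (hf trivial) (hg trivial)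
  | add f g hf hg =>
    rw [map_add]
    exact add_mem (hf trivial) (hg trivial)

lemma dword_eq_divDiffWord (d : ℕ → OPol a →+ OPol a) (l : List ℕ) :
    dword d l = divDiffWord d l := by
  induction l with
  | nil => rfl
  | cons i l ih => exact congrArg (d i).comp ih

lemma schurP_eq_schur (d : ℕ → OPol a →+ OPol a) (W0 : OPol a →+* OPol a) (α : Fin a → ℕ) :
    schurP a d W0 α = IsOddDividedDifference.schur OX d W0 α := by
  rw [schurP, dword_eq_divDiffWord]
  exact neg_one_pow_mul_eq_zsmul _ _

lemma isOddDividedDifference_OX {s : ℕ → OPol a →+* OPol a} {d : ℕ → OPol a →+ OPol a}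
    (hs : ∀ i j : ℕ, 1 ≤ i → i + 1 ≤ a → 1 ≤ j → j ≤ a →
      s i (xv a j) =
        if j = i then -xv a (i + 1) else if j = i + 1 then -xv a i else -xv a j)
    (hd1 : ∀ i : ℕ, 1 ≤ i → i + 1 ≤ a → d i 1 = 0)
    (hdx : ∀ i j : ℕ, 1 ≤ i → i + 1 ≤ a → 1 ≤ j → j ≤ a →
      d i (xv a j) = if j = i ∨ j = i + 1 then 1 else 0)
    (hdL : ∀ i : ℕ, 1 ≤ i → i + 1 ≤ a → ∀ f g : OPol a,
      d i (f * g) = d i f * g + s i f * d i g) :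
    IsOddDividedDifference (R := OPol a) OX s d where
  anticomm i j hij := OX_mul_OX_of_ne hij
  closure_range := closure_range_OX
  map_fst p q hpq := by
    have hq := hs q (p + 1) (by lia) q.isLt (by lia) p.isLt
    rw [if_pos hpq.symm, xv_succ, xv_succ] at hq
    exact hq
  map_snd p q hpq := by
    have hq := hs q (q + 1) (by lia) q.isLt (by lia) q.isLt
    rw [if_neg (by lia), if_pos rfl, xv_succ, hpq, xv_succ, ← hpq] at hq
    exact hq
  map_far q j hq hqj hjq := by
    have hj := hs q (j + 1) hq q.isLt (by lia) j.isLt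
    rw [if_neg (by lia), if_neg (by lia), xv_succ] at hj
    exact hj
  diff_one q hq := hd1 q hq q.isLt
  diff_fst p q hpq := by
    have hq := hdx q (p + 1) (by lia) q.isLt (by lia) p.isLt
    rw [if_pos (by lia), xv_succ] at hq
    exact hq
  diff_snd p q hpq := by
    have hq := hdx q (q + 1) (by lia) q.isLt (by lia) q.isLt
    rw [if_pos (by lia), xv_succ] at hq
    exact hq
  diff_far q j hq hqj hjq := by
    have hj := hdx q (j + 1) hq q.isLt (by lia) j.isLt
    rw [if_neg (by lia), xv_succ] at hj
    exact hj
  leibniz q hq := hdL q hq q.isLt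

end OddPolynomials

open Classical in
/-- the odd Pieri rule: s_α·s_{(1^k)} = Σ ± s_μ over the ways of adding a
vertical strip of length k to α, with the stated signs. -/
theorem odd_pieri_rule (a k : ℕ) (hk1 : 1 ≤ k) (hka : k ≤ a)
    (α : Fin a → ℕ) (hα : Antitone α)
    (s : ℕ → OPol a →+* OPol a)
    (hs : ∀ i j : ℕ, 1 ≤ i → i + 1 ≤ a → 1 ≤ j → j ≤ a →
      s i (xv a j) =
        if j = i then -xv a (i + 1) else if j = i + 1 then -xv a i else -xv a j)
    (d : ℕ → OPol a →+ OPol a)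
    (hd1 : ∀ i : ℕ, 1 ≤ i → i + 1 ≤ a → d i 1 = 0)
    (hdx : ∀ i j : ℕ, 1 ≤ i → i + 1 ≤ a → 1 ≤ j → j ≤ a →
      d i (xv a j) = if j = i ∨ j = i + 1 then 1 else 0)
    (hdL : ∀ i : ℕ, 1 ≤ i → i + 1 ≤ a → ∀ f g : OPol a,
      d i (f * g) = d i f * g + s i f * d i g)
    (W0 : OPol a →+* OPol a)
    (hW0 : ∀ i : Fin a, W0 (OX i) = (-1 : OPol a) ^ Nat.choose a 2 * OX (Fin.rev i)) :
    schurP a d W0 α * schurP a d W0 (fun i => if (i : ℕ) < k then 1 else 0) =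
      ∑ I ∈ Finset.powersetCard k (Finset.univ : Finset (Fin a)),
        if Antitone (fun j => α j + if j ∈ I then 1 else 0) then
          (-1 : OPol a) ^
              (∑ i ∈ I, ∑ l ∈ Finset.univ.filter (fun l => i < l), α l) *
            schurP a d W0 (fun j => α j + if j ∈ I then 1 else 0)
        else 0 := by
  have h : IsOddDividedDifference (R := OPol a) OX s d := isOddDividedDifference_OX hs hd1 hdx hdL
  rw [schurP_eq_schur, schurP_eq_schur]
  refine (h.schur_mul_schur_column W0 hα hka).trans (Finset.sum_congr rfl fun I _ => ?_)
  change (if Antitone (α + indicatorExp I) then _ else _) =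
    if Antitone (α + indicatorExp I) then _ else _
  split_ifs
  · rw [schurP_eq_schur]
    exact (neg_one_pow_mul_eq_zsmul _ _).symm
  · rfl
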